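/- Let G be a group, N a subgroup of index 2, s ∈ G ∖ N, σ(n) = s⁻¹ns, and V = ℂ². Let π₁, π₂ : N → GL(V) be group homomorphisms, and assume r(det∘π₁) = r(det∘π₂) as homomorphisms G → ℂˣ. Then the tensor inductions As(π₁) and As(π₂) are conjugate in GL(V ⊗ V) if and only if there exists a homomorphism χ : N → ℂˣ with r(χ) trivial such that π₂ ⊗ χ (the homomorphism n ↦ χ(n)·π₂(n)) is conjugate in GL(V) either to π₁ or to π₁ ∘ σ. -/

import Mathlib

open scoped TensorProduct

/-- `AsaiProp N s π F` says that the homomorphism `F : G → GL(V ⊗ V)` satisfies the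
defining equations of the tensor induction (Asai lift) of `π : N → GL(V)` with respect
to the element `s ∈ G ∖ N`: for `n ∈ N`, `F(n)(v ⊗ w) = π(n)v ⊗ π(s⁻¹ns)w`, and
`F(s)(v ⊗ w) = π(s²)w ⊗ v`. -/
def AsaiProp {G : Type} [Group G] (N : Subgroup G) (s : G)
    (π : ↥N →* ((Fin 2 → ℂ) ≃ₗ[ℂ] (Fin 2 → ℂ)))
    (F : G →* ((TensorProduct ℂ (Fin 2 → ℂ) (Fin 2 → ℂ)) ≃ₗ[ℂ]
      (TensorProduct ℂ (Fin 2 → ℂ) (Fin 2 → ℂ)))) : Prop :=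
  (∀ (n : ↥N) (hc : s⁻¹ * ↑n * s ∈ N) (v w : Fin 2 → ℂ),
      F ↑n (v ⊗ₜ[ℂ] w) = (π n v) ⊗ₜ[ℂ] (π ⟨s⁻¹ * ↑n * s, hc⟩ w))
  ∧ (∀ (h2 : s ^ 2 ∈ N) (v w : Fin 2 → ℂ),
      F s (v ⊗ₜ[ℂ] w) = (π ⟨s ^ 2, h2⟩ w) ⊗ₜ[ℂ] v)

open Polynomial in
/-- An invertible complex operator has a square root that is a polynomial in it. -/
theorem exists_aeval_mul_self_eq {V : Type*} [AddCommGroup V] [Module ℂ V]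
    [FiniteDimensional ℂ V] (f : Module.End ℂ V) (hf : IsUnit f) :
    ∃ p : ℂ[X], aeval f p * aeval f p = f := by
  classical
  set m := minpoly ℂ f
  have hm : m.Monic := minpoly.monic (Algebra.IsIntegral.isIntegral f)
  choose r hr using fun x : ℂ => IsAlgClosed.exists_eq_mul_self x
  set q := Lagrange.interpolate m.roots.toFinset id r
  have hdvd : m ∣ (q ^ 2 - X) ^ m.roots.card := by
    have hs : m = (m.roots.map fun a => X - C a).prod := by
      simpa [hm.leadingCoeff] using (IsAlgClosed.splits m).eq_prod_roots
    conv_lhs => rw [hs]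
    rw [← Multiset.prod_replicate, ← Multiset.map_const']
    refine Multiset.prod_dvd_prod_of_dvd _ _ fun a ha => dvd_iff_isRoot.mpr ?_
    have hq : q.eval a = r a :=
      Lagrange.eval_interpolate_at_node r (Set.injOn_id _) (Multiset.mem_toFinset.mpr ha)
    rw [IsRoot.def, eval_sub, eval_pow, hq, eval_X, sq, ← hr, sub_self]
  let A := Algebra.adjoin ℂ {f}
  let x : A := ⟨f, Algebra.self_mem_adjoin_singleton ℂ f⟩
  have hx (p : ℂ[X]) : ((aeval x p : A) : Module.End ℂ V) = aeval f p :=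
    (aeval_subalgebra_coe p A x).symm ▸ rfl
  have hxu : IsUnit x := by
    have : IsArtinianRing A := IsArtinianRing.of_finite ℂ A
    refine IsArtinianRing.isUnit_of_mem_nonZeroDivisors
      (mem_nonZeroDivisors_iff_right.mpr fun y hy => ?_)
    exact Subtype.ext (hf.mul_left_eq_zero.mp (congrArg Subtype.val hy))
  have hnil : IsNilpotent (aeval x q ^ 2 - x) := by
    refine ⟨m.roots.card, Subtype.ext ?_⟩
    have : aeval f ((q ^ 2 - X) ^ m.roots.card) = 0 :=
      aeval_eq_zero_of_dvd_aeval_eq_zero hdvd (minpoly.aeval ℂ f)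
    rw [← hx] at this
    simpa using this
  have hqu : IsUnit (aeval x q) := by
    have h : IsUnit (aeval x q ^ 2) := by
      simpa using hnil.isUnit_add_left_of_commute hxu (Commute.all _ _)
    exact (isUnit_pow_iff two_ne_zero).mp h
  obtain ⟨y, ⟨-, hy⟩, -⟩ := existsUnique_nilpotent_sub_and_aeval_eq_zero
    (P := (X ^ 2 - C x : A[X])) (x := aeval x q) (by simpa using hnil)
    (by
      have h2 : IsUnit (2 : A) := by
        simpa only [map_ofNat] using (IsUnit.mk0 (2 : ℂ) two_ne_zero).map (algebraMap ℂ A)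
      simpa [one_add_one_eq_two] using And.intro h2 hqu)
  have hyx : (y : Module.End ℂ V) * y = f := by
    have h : y ^ 2 = x := by simpa [sub_eq_zero] using hy
    simpa [sq] using congrArg Subtype.val h
  obtain ⟨p, hp⟩ := (AlgHom.mem_range _).mp
    ((Algebra.adjoin_singleton_eq_range_aeval ℂ f).le y.2)
  refine ⟨p, Eq.trans ?_ hyx⟩
  rw [← hp]

theorem isAdjointPair_aeval {V : Type*} [AddCommGroup V] [Module ℂ V]
    {β : LinearMap.BilinForm ℂ V} {f : Module.End ℂ V}
    (hf : LinearMap.IsAdjointPair β β f f) (p : Polynomial ℂ) :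
    LinearMap.IsAdjointPair β β (Polynomial.aeval f p) (Polynomial.aeval f p) := by
  induction p using Polynomial.induction_on with
  | C a =>
    intro x y
    simp [Module.algebraMap_end_apply]
  | add p q hp hq =>
    rw [map_add]
    exact hp.add hq
  | monomial n a h =>
    have hcomm : Polynomial.aeval f (Polynomial.C a * Polynomial.X ^ (n + 1)) =
        f * Polynomial.aeval f (Polynomial.C a * Polynomial.X ^ n) := by
      rw [pow_succ', mul_left_comm, map_mul, Polynomial.aeval_X]
    have hcomm' : Polynomial.aeval f (Polynomial.C a * Polynomial.X ^ (n + 1)) =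
        Polynomial.aeval f (Polynomial.C a * Polynomial.X ^ n) * f := by
      rw [pow_succ, ← mul_assoc, map_mul, Polynomial.aeval_X]
    intro x y
    nth_rewrite 1 [hcomm]
    rw [hcomm']
    exact hf.mul h x y

/-- If `T` intertwines similitudes of a symmetric nondegenerate form with equal factors, then the
isometry in its polar decomposition intertwines them too. -/
theorem exists_isometry_intertwining {V : Type*} [AddCommGroup V] [Module ℂ V]
    [FiniteDimensional ℂ V] {β : LinearMap.BilinForm ℂ V} (hβ : β.Nondegenerate)
    (hsymm : ∀ x y, β x y = β y x) (T : V ≃ₗ[ℂ] V) :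
    ∃ T' : V →ₗ[ℂ] V, (∀ x y, β (T' x) (T' y) = β x y) ∧
      ∀ (R R' : V →ₗ[ℂ] V) (c : ℂ), Function.Surjective R →
        (∀ x y, β (R x) (R y) = c * β x y) → (∀ x y, β (R' x) (R' y) = c * β x y) →
        (∀ x, T (R x) = R' (T x)) → ∀ x, T' (R x) = R' (T' x) := by
  set S : Module.End ℂ V := β.leftAdjointOfNondegenerate hβ T ∘ₗ T with hS
  have hST (x y : V) : β (S x) y = β (T x) (T y) :=
    β.isAdjointPairLeftAdjointOfNondegenerate hβ T (T x) y
  have hSadj (x y : V) : β (S x) y = β x (S y) := by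
    rw [hST, hsymm, ← hST, hsymm]
  have hSinj : Function.Injective S := by
    refine (injective_iff_map_eq_zero S).mpr fun x hx => ?_
    refine T.map_eq_zero_iff.mp (hβ.1 _ fun y => ?_)
    rw [← T.apply_symm_apply y, ← hST, hx, map_zero, LinearMap.zero_apply]
  have hSu : IsUnit S := (LinearMap.isUnit_iff_ker_eq_bot S).mpr (LinearMap.ker_eq_bot.mpr hSinj)
  obtain ⟨p, hp⟩ := exists_aeval_mul_self_eq S hSu
  set P := Polynomial.aeval S p
  have hPu : IsUnit P := ((Commute.refl P).isUnit_mul_iff.mp (hp ▸ hSu)).1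
  obtain ⟨P', hPP', hP'P⟩ := isUnit_iff_exists.mp hPu
  have hPadj : ∀ x y, β (P x) y = β x (P y) := isAdjointPair_aeval hSadj p
  refine ⟨T ∘ₗ P', fun x y => ?_, fun R R' c hR hRβ hRβ' hTR x => ?_⟩
  · have h (z : V) : P (P' z) = z := LinearMap.congr_fun hPP' z
    rw [LinearMap.comp_apply, LinearMap.comp_apply, LinearEquiv.coe_coe, ← hST, ← hp,
      Module.End.mul_apply, hPadj, h, h]
  · have hSR : Commute S R := by
      refine LinearMap.ext fun x => sub_eq_zero.mp (hβ.1 _ fun y => ?_)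
      obtain ⟨y, rfl⟩ := hR y
      rw [Module.End.mul_apply, Module.End.mul_apply, map_sub, LinearMap.sub_apply, hST, hTR, hTR,
        hRβ', hRβ, hST, sub_self]
    have hPR : Commute P R :=
      Algebra.commute_of_mem_adjoin_singleton_of_commute
        (Polynomial.aeval_mem_adjoin_singleton ℂ S) hSR.symm |>.symm
    have hP'R : P' * R = R * P' := by
      calc P' * R = P' * (R * P) * P' := by rw [mul_assoc, mul_assoc, hPP', mul_one]
        _ = R * P' := by rw [← hPR.eq, ← mul_assoc, hP'P, one_mul]
    have h : P' (R x) = R (P' x) := LinearMap.congr_fun hP'R x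
    simp [h, hTR]

/-- The polar form of the determinant on `2 × 2` matrices. -/
noncomputable def detPolar : LinearMap.BilinForm ℂ (Matrix (Fin 2) (Fin 2) ℂ) :=
  LinearMap.mk₂ ℂ (fun X Y => (X * Y.adjugate).trace)
    (by intros; simp [Matrix.adjugate_fin_two, Matrix.trace_fin_two, Matrix.mul_apply]; ring)
    (by intros; simp [Matrix.adjugate_fin_two, Matrix.trace_fin_two, Matrix.mul_apply])
    (by intros; simp [Matrix.adjugate_fin_two, Matrix.trace_fin_two, Matrix.mul_apply]; ring)
    (by intros; simp [Matrix.adjugate_fin_two, Matrix.trace_fin_two, Matrix.mul_apply]; ring)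

theorem detPolar_apply (X Y : Matrix (Fin 2) (Fin 2) ℂ) :
    detPolar X Y = X 0 0 * Y 1 1 - X 0 1 * Y 1 0 - X 1 0 * Y 0 1 + X 1 1 * Y 0 0 := by
  simp [detPolar, Matrix.adjugate_fin_two, Matrix.trace_fin_two, Matrix.mul_apply]; ring

theorem detPolar_self (X : Matrix (Fin 2) (Fin 2) ℂ) : detPolar X X = 2 * X.det := by
  rw [detPolar_apply, Matrix.det_fin_two]; ring

theorem detPolar_mul_mul (P X Y Q : Matrix (Fin 2) (Fin 2) ℂ) :
    detPolar (P * X * Q) (P * Y * Q) = P.det * Q.det * detPolar X Y := by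
  simp [detPolar_apply, Matrix.det_fin_two, Matrix.mul_apply]; ring

theorem detPolar_transpose (X Y : Matrix (Fin 2) (Fin 2) ℂ) :
    detPolar X.transpose Y.transpose = detPolar X Y := by
  simp [detPolar_apply]; ring

theorem detPolar_nondegenerate : detPolar.Nondegenerate := by
  constructor
  · intro X h
    have h0 := h (Matrix.single 0 0 1)
    have h1 := h (Matrix.single 0 1 1)
    have h2 := h (Matrix.single 1 0 1)
    have h3 := h (Matrix.single 1 1 1)
    simp [detPolar_apply] at h0 h1 h2 h3
    ext i j
    fin_cases i <;> fin_cases j <;> simp [*]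
  · intro X h
    have h0 := h (Matrix.single 0 0 1)
    have h1 := h (Matrix.single 0 1 1)
    have h2 := h (Matrix.single 1 0 1)
    have h3 := h (Matrix.single 1 1 1)
    simp [detPolar_apply] at h0 h1 h2 h3
    ext i j
    fin_cases i <;> fin_cases j <;> simp [*]

section

open Matrix

theorem exists_det_ne_zero_mul_eq_mul_single {E : Matrix (Fin 2) (Fin 2) ℂ} (hdet : E.det = 0)
    (htr : E.trace = 1) : ∃ Q : Matrix (Fin 2) (Fin 2) ℂ, Q.det ≠ 0 ∧ E * Q = Q * single 0 0 1 := by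
  rw [det_fin_two] at hdet
  rw [trace_fin_two] at htr
  by_cases h : E 0 0 = 0
  · refine ⟨!![E 0 1, E 1 1; E 1 1, -E 1 0], ?_, ?_⟩
    · rw [det_fin_two_of]
      have h1 : E 1 1 = 1 := by linear_combination htr - h
      rw [h, h1] at hdet
      rw [h1]
      intro h2
      have : (1 : ℂ) = 0 := by linear_combination -h2 + hdet
      exact one_ne_zero this
    · ext i j
      fin_cases i <;> fin_cases j <;> simp [mul_apply] <;> grind
  · refine ⟨!![E 0 0, -E 0 1; E 1 0, E 0 0], ?_, ?_⟩
    · rw [det_fin_two_of]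
      intro h2
      exact h (by linear_combination h2 + hdet - E 0 0 * htr)
    · ext i j
      fin_cases i <;> fin_cases j <;> simp [mul_apply] <;> grind

theorem linearMap_apply_eq_sum_single {M : Type*} [AddCommGroup M] [Module ℂ M]
    (T : Matrix (Fin 2) (Fin 2) ℂ →ₗ[ℂ] M) (X : Matrix (Fin 2) (Fin 2) ℂ) :
    T X = X 0 0 • T (single 0 0 1) + X 0 1 • T (single 0 1 1) + X 1 0 • T (single 1 0 1) +
      X 1 1 • T (single 1 1 1) := by
  simp only [← map_smul, ← map_add]
  congr 1
  ext i j
  fin_cases i <;> fin_cases j <;> simp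

theorem exists_eq_mul_mul_of_map_single
    {T : Matrix (Fin 2) (Fin 2) ℂ →ₗ[ℂ] Matrix (Fin 2) (Fin 2) ℂ}
    (hT : ∀ X Y, detPolar (T X) (T Y) = detPolar X Y) (h1 : T 1 = 1)
    (h00 : T (single 0 0 1) = single 0 0 1) :
    ∃ P Q : Matrix (Fin 2) (Fin 2) ℂ, P.det ≠ 0 ∧ Q.det ≠ 0 ∧
      ((∀ X, T X = P * X * Q) ∨ ∀ X, T X = P * Xᵀ * Q) := by
  have h11 : T (single 1 1 1) = single 1 1 1 := by
    have h : (single 1 1 1 : Matrix (Fin 2) (Fin 2) ℂ) = 1 - single 0 0 1 := by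
      ext i j
      fin_cases i <;> fin_cases j <;> simp
    rw [h, map_sub, h1, h00]
  set A := T (single 0 1 1) with hA
  set B := T (single 1 0 1) with hB
  have hAA := hT (single 0 1 1) (single 0 1 1)
  have hBB := hT (single 1 0 1) (single 1 0 1)
  have hAB := hT (single 0 1 1) (single 1 0 1)
  have hA0 := hT (single 0 1 1) (single 0 0 1)
  have hA1 := hT (single 0 1 1) (single 1 1 1)
  have hB0 := hT (single 1 0 1) (single 0 0 1)
  have hB1 := hT (single 1 0 1) (single 1 1 1)
  simp only [← hA, ← hB, h00, h11, detPolar_apply] at hAA hBB hAB hA0 hA1 hB0 hB1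
  simp at hAA hBB hAB hA0 hA1 hB0 hB1
  have key (X) : T X =
      !![X 0 0, X 0 1 * A 0 1 + X 1 0 * B 0 1; X 0 1 * A 1 0 + X 1 0 * B 1 0, X 1 1] := by
    rw [linearMap_apply_eq_sum_single, ← hA, ← hB, h00, h11]
    ext i j
    fin_cases i <;> fin_cases j <;> simp [hA0, hA1, hB0, hB1]
  by_cases h : A 1 0 = 0
  · have hα : A 0 1 ≠ 0 := by
      intro h'
      simp [h, h', hA0, hA1] at hAB
    have hB01 : B 0 1 = 0 := by grind
    have hB10 : B 1 0 = (A 0 1)⁻¹ := by grind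
    refine ⟨!![A 0 1, 0; 0, 1], !![(A 0 1)⁻¹, 0; 0, 1], by simpa, by simpa, Or.inl fun X => ?_⟩
    rw [key]
    ext i j
    fin_cases i <;> fin_cases j <;>
      simp [mul_apply, vecMul, dotProduct, Fin.sum_univ_two, h, hB01, hB10, hα, mul_comm, mul_assoc]
  · have hA01 : A 0 1 = 0 := by grind
    have hB10 : B 1 0 = 0 := by grind
    have hB01 : B 0 1 = (A 1 0)⁻¹ := by grind
    refine ⟨!![(A 1 0)⁻¹, 0; 0, 1], !![A 1 0, 0; 0, 1], by simpa, by simpa, Or.inr fun X => ?_⟩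
    rw [key]
    ext i j
    fin_cases i <;> fin_cases j <;>
      simp [mul_apply, vecMul, dotProduct, Fin.sum_univ_two, h, hA01, hB01, hB10, mul_comm,
        mul_assoc]

/-- A linear isometry of the determinant form on `2 × 2` matrices is `X ↦ P * X * Q` or
`X ↦ P * Xᵀ * Q`. -/
theorem exists_eq_mul_mul {T : Matrix (Fin 2) (Fin 2) ℂ →ₗ[ℂ] Matrix (Fin 2) (Fin 2) ℂ}
    (hT : ∀ X Y, detPolar (T X) (T Y) = detPolar X Y) :
    ∃ P Q : Matrix (Fin 2) (Fin 2) ℂ, P.det ≠ 0 ∧ Q.det ≠ 0 ∧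
      ((∀ X, T X = P * X * Q) ∨ ∀ X, T X = P * Xᵀ * Q) := by
  have hdet (X) : (T X).det = X.det := by
    have h := hT X X
    rw [detPolar_self, detPolar_self] at h
    exact mul_left_cancel₀ two_ne_zero h
  have hM : (T 1).det = 1 := by rw [hdet, det_one]
  have hMu : IsUnit (T 1).det := by simp [hM]
  set E := (T 1)⁻¹ * T (single 0 0 1) with hE
  have hE0 : E.det = 0 := by
    rw [hE, det_mul, hdet, det_fin_two (single 0 0 1)]
    simp
  have hE1 : E.trace = 1 := by
    have h := detPolar_mul_mul (T 1)⁻¹ (T (single 0 0 1)) (T 1) 1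
    rw [hT, mul_one, mul_one, nonsing_inv_mul _ hMu, ← hE, det_nonsing_inv, hM] at h
    simp [detPolar_apply] at h
    rw [trace_fin_two, h]
  obtain ⟨Q, hQ, hEQ⟩ := exists_det_ne_zero_mul_eq_mul_single hE0 hE1
  have hQu : IsUnit Q.det := hQ.isUnit
  let W : Matrix (Fin 2) (Fin 2) ℂ →ₗ[ℂ] Matrix (Fin 2) (Fin 2) ℂ :=
    LinearMap.mulRight ℂ Q ∘ₗ LinearMap.mulLeft ℂ (Q⁻¹ * (T 1)⁻¹) ∘ₗ T
  have hW (X) : W X = Q⁻¹ * (T 1)⁻¹ * T X * Q := rfl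
  have hTW (X) : T X = T 1 * Q * W X * Q⁻¹ := by
    rw [hW]
    simp only [mul_assoc, mul_nonsing_inv _ hQu, mul_one]
    rw [mul_nonsing_inv_cancel_left _ _ hQu, mul_nonsing_inv_cancel_left _ _ hMu]
  obtain ⟨P', Q', hP', hQ', h⟩ := exists_eq_mul_mul_of_map_single (T := W)
    (fun X Y => by
      rw [hW, hW, detPolar_mul_mul, hT, det_mul, det_nonsing_inv, det_nonsing_inv, hM]
      simp [hQ])
    (by rw [hW, mul_assoc Q⁻¹, nonsing_inv_mul _ hMu, mul_one, nonsing_inv_mul _ hQu])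
    (by rw [hW, mul_assoc Q⁻¹, ← hE, mul_assoc, hEQ, nonsing_inv_mul_cancel_left _ _ hQu])
  refine ⟨T 1 * Q * P', Q' * Q⁻¹, ?_, ?_, h.imp (fun h X => ?_) (fun h X => ?_)⟩
  · simp [hM, hQ, hP']
  · simp [hQ, hQ']
  · rw [hTW X, h]
    simp only [mul_assoc]
  · rw [hTW X, h]
    simp only [mul_assoc]

theorem exists_smul_of_mul_mul_eq {P P' Q Q' : Matrix (Fin 2) (Fin 2) ℂ} (hP' : P'.det ≠ 0)
    (hQ : Q.det ≠ 0) (h : ∀ X, P * X * Q = P' * X * Q') :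
    ∃ c : ℂ, P = c • P' ∧ Q' = c • Q := by
  have hc (X) : P'⁻¹ * P * X = X * (Q' * Q⁻¹) := by
    have := congrArg (fun Y => P'⁻¹ * Y * Q⁻¹) (h X)
    simpa only [mul_assoc, mul_nonsing_inv _ hQ.isUnit, mul_one,
      nonsing_inv_mul_cancel_left _ _ hP'.isUnit] using this
  have h1 : P'⁻¹ * P = Q' * Q⁻¹ := by simpa using hc 1
  obtain ⟨c, hc'⟩ := mem_range_scalar_of_commute_single (M := Q' * Q⁻¹) fun i j _ => by
    have := hc (single i j 1)
    rw [h1] at this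
    exact this.symm
  rw [scalar_apply, ← smul_one_eq_diagonal] at hc'
  refine ⟨c, ?_, ?_⟩
  · rw [← mul_nonsing_inv_cancel_left P' P hP'.isUnit, h1, ← hc', Matrix.mul_smul, mul_one]
  · rw [← nonsing_inv_mul_cancel_right Q Q' hQ.isUnit, ← hc', smul_mul, one_mul]

theorem exists_character {N : Type*} [Group N] (A B : N →* Matrix (Fin 2) (Fin 2) ℂ)
    {P : Matrix (Fin 2) (Fin 2) ℂ} (hP : P.det ≠ 0)
    (h : ∀ n, ∃ c : ℂ, P * A n = c • (B n * P)) :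
    ∃ χ : N →* ℂˣ, ∀ n, P * A n = (χ n : ℂ) • (B n * P) := by
  choose c hc using h
  have hne (n) : B n * P ≠ 0 := by
    have hPu : IsUnit P := (isUnit_iff_isUnit_det P).mpr hP.isUnit
    exact (((Group.isUnit n).map B).mul hPu).ne_zero
  let χ : N →* ℂ :=
    { toFun := c
      map_one' := by
        refine smul_left_injective ℂ (hne 1) ?_
        beta_reduce
        rw [← hc, map_one, map_one, mul_one, one_mul, one_smul]
      map_mul' := fun m n => by
        refine smul_left_injective ℂ (hne (m * n)) ?_
        simp only [← hc]
        rw [map_mul, ← mul_assoc, hc, smul_mul, mul_assoc, hc, Matrix.mul_smul, smul_smul,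
          map_mul, mul_assoc] }
  exact ⟨χ.toHomUnits, hc⟩

theorem exists_character_of_intertwining {N : Type*} [Group N] (σ : N →* N) (z : N) (hσz : σ z = z)
    (hσσ : ∀ n, z * σ (σ n) = n * z) (A B : N →* Matrix (Fin 2) (Fin 2) ℂ)
    {T : Matrix (Fin 2) (Fin 2) ℂ →ₗ[ℂ] Matrix (Fin 2) (Fin 2) ℂ}
    (hT : ∀ X Y, detPolar (T X) (T Y) = detPolar X Y)
    (hTn : ∀ n X, T (A n * X * (A (σ n))ᵀ) = B n * T X * (B (σ n))ᵀ)
    (hTz : ∀ X, T (A z * Xᵀ) = B z * (T X)ᵀ) :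
    ∃ χ : N →* ℂˣ, (∀ n, χ n * χ (σ n) = 1) ∧ χ z = 1 ∧
      ∃ P : Matrix (Fin 2) (Fin 2) ℂ, P.det ≠ 0 ∧
        ((∀ n, P * A n = (χ n : ℂ) • (B n * P)) ∨
          ∀ n, P * A (σ n) = (χ n : ℂ) • (B n * P)) := by
  obtain ⟨P, Q, hP, hQ, h⟩ := exists_eq_mul_mul hT
  have hA (n) : IsUnit (A n) := (Group.isUnit n).map A
  have hB (n) : IsUnit (B n) := (Group.isUnit n).map B
  have hdet {M : Matrix (Fin 2) (Fin 2) ℂ} (hM : IsUnit M) : M.det ≠ 0 :=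
    ((isUnit_iff_isUnit_det M).mp hM).ne_zero
  have hBP (n) : B n * P ≠ 0 :=
    ((hB n).mul ((isUnit_iff_isUnit_det P).mpr hP.isUnit)).ne_zero
  have hBPdet (n) : (B n * P).det ≠ 0 := by
    rw [det_mul]
    exact mul_ne_zero (hdet (hB n)) hP
  have hAQdet (n) : ((A n)ᵀ * Q).det ≠ 0 := by
    rw [det_mul, det_transpose]
    exact mul_ne_zero (hdet (hA n)) hQ
  rcases h with h | h
  · have key (n) : ∃ c : ℂ, P * A n = c • (B n * P) ∧ Q * (B (σ n))ᵀ = c • ((A (σ n))ᵀ * Q) :=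
      exists_smul_of_mul_mul_eq (hBPdet n) (hAQdet (σ n)) fun X => by
        have := hTn n X
        rw [h, h] at this
        simpa only [mul_assoc] using this
    obtain ⟨d, hd, hd'⟩ : ∃ d : ℂ, P * A z = d • (B z * Qᵀ) ∧ Pᵀ = d • Q :=
      exists_smul_of_mul_mul_eq
        (by rw [det_mul, det_transpose]; exact mul_ne_zero (hdet (hB z)) hQ) hQ fun X => by
        have := hTz Xᵀ
        rw [h, h, transpose_mul, transpose_mul, transpose_transpose] at this
        simpa only [mul_assoc] using this
    have hPQ : P = d • Qᵀ := by rw [← transpose_transpose P, hd', transpose_smul]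
    obtain ⟨χ, hχ⟩ := exists_character A B hP fun n => (key n).imp fun c hc => hc.1
    refine ⟨χ, fun n => Units.ext ?_, Units.ext ?_, P, hP, Or.inl hχ⟩
    · obtain ⟨c, hc, hc'⟩ := key n
      have hcχ : c = χ n := smul_left_injective ℂ (hBP n) (hc.symm.trans (hχ n))
      have hσ : B (σ n) * P = c • (P * A (σ n)) := by
        have := congrArg transpose hc'
        rw [transpose_mul, transpose_smul, transpose_mul, transpose_transpose,
          transpose_transpose] at this
        rw [hPQ, Matrix.mul_smul, this, smul_mul, smul_comm]
      refine smul_left_injective ℂ (hBP (σ n)) ?_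
      rw [hχ, smul_smul, hcχ] at hσ
      simpa using hσ.symm
    · refine smul_left_injective ℂ (hBP z) ?_
      simp only [← hχ, Units.val_one, one_smul]
      rw [hd, ← Matrix.mul_smul, ← hPQ]
  · have key (n) : ∃ c : ℂ, P * A (σ n) = c • (B n * P) ∧ Q * (B (σ n))ᵀ = c • ((A n)ᵀ * Q) :=
      exists_smul_of_mul_mul_eq (hBPdet n) (hAQdet n) fun X => by
        have := hTn n Xᵀ
        rw [h, h, transpose_mul, transpose_mul, transpose_transpose, transpose_transpose] at this
        simpa only [mul_assoc] using this
    obtain ⟨d, hd, hd'⟩ : ∃ d : ℂ, P = d • (B z * Qᵀ) ∧ Pᵀ = d • ((A z)ᵀ * Q) :=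
      exists_smul_of_mul_mul_eq
        (by rw [det_mul, det_transpose]; exact mul_ne_zero (hdet (hB z)) hQ) (hAQdet z) fun X => by
        have := hTz X
        rw [h, h, transpose_mul, transpose_mul, transpose_transpose, transpose_mul,
          transpose_transpose] at this
        simpa only [mul_assoc] using this
    have hPQ : P = d • (Qᵀ * A z) := by
      rw [← transpose_transpose P, hd', transpose_smul, transpose_mul, transpose_transpose]
    obtain ⟨χ, hχ⟩ := exists_character (A.comp σ) B hP fun n => (key n).imp fun c hc => hc.1
    refine ⟨χ, fun n => Units.ext ?_, Units.ext ?_, P, hP, Or.inr hχ⟩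
    · obtain ⟨c, hc, hc'⟩ := key n
      have hcχ : c = χ n := smul_left_injective ℂ (hBP n) (hc.symm.trans (hχ n))
      have hσ : B (σ n) * P = c • (P * A (σ (σ n))) := by
        have := congrArg transpose hc'
        rw [transpose_mul, transpose_smul, transpose_mul, transpose_transpose,
          transpose_transpose] at this
        rw [hPQ, Matrix.mul_smul, ← mul_assoc, this, smul_mul, smul_mul, mul_assoc, mul_assoc,
          ← map_mul, ← map_mul, hσσ, smul_comm]
      refine smul_left_injective ℂ (hBP (σ n)) ?_
      have hχσ := hχ (σ n)
      rw [MonoidHom.comp_apply] at hχσ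
      rw [hχσ, smul_smul, hcχ] at hσ
      simpa using hσ.symm
    · refine smul_left_injective ℂ (hBP z) ?_
      simp only [← hχ, Units.val_one, one_smul]
      rw [MonoidHom.comp_apply, hσz]
      conv_lhs => rw [hd]
      conv_rhs => rw [hPQ]
      rw [smul_mul, Matrix.mul_smul, mul_assoc]

/-- The identification of `ℂ² ⊗ ℂ²` with `2 × 2` matrices sending `v ⊗ w` to `v wᵀ`. -/
noncomputable def tensorEquivMatrix :
    TensorProduct ℂ (Fin 2 → ℂ) (Fin 2 → ℂ) ≃ₗ[ℂ] Matrix (Fin 2) (Fin 2) ℂ :=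
  ((Pi.basisFun ℂ (Fin 2)).tensorProduct (Pi.basisFun ℂ (Fin 2))).equivFun ≪≫ₗ
    LinearEquiv.curry ℂ ℂ (Fin 2) (Fin 2) ≪≫ₗ Matrix.ofLinearEquiv ℂ

theorem tensorEquivMatrix_tmul (v w : Fin 2 → ℂ) :
    tensorEquivMatrix (v ⊗ₜ[ℂ] w) = vecMulVec v w := by
  ext i j
  simp [tensorEquivMatrix, vecMulVec_apply, mul_comm]

/-- The matrix form of a representation on `ℂ²`. -/
noncomputable def matrixRep {N : Type*} [Group N]
    (π : N →* ((Fin 2 → ℂ) ≃ₗ[ℂ] (Fin 2 → ℂ))) : N →* Matrix (Fin 2) (Fin 2) ℂ where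
  toFun n := LinearMap.toMatrix' (π n).toLinearMap
  map_one' := by
    rw [map_one]
    exact LinearMap.toMatrix'_id
  map_mul' m n := by
    rw [map_mul]
    exact LinearMap.toMatrix'_comp _ _

theorem matrixRep_mulVec {N : Type*} [Group N] (π : N →* ((Fin 2 → ℂ) ≃ₗ[ℂ] (Fin 2 → ℂ)))
    (n : N) (v : Fin 2 → ℂ) : matrixRep π n *ᵥ v = π n v :=
  LinearMap.toMatrix'_mulVec (π n).toLinearMap v

theorem det_matrixRep {N : Type*} [Group N] (π : N →* ((Fin 2 → ℂ) ≃ₗ[ℂ] (Fin 2 → ℂ)))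
    (n : N) : (matrixRep π n).det = LinearMap.det (π n).toLinearMap :=
  LinearMap.det_toMatrix' _

theorem tensorEquivMatrix_asai {G : Type} [Group G] {N : Subgroup G} {s : G}
    {π : ↥N →* ((Fin 2 → ℂ) ≃ₗ[ℂ] (Fin 2 → ℂ))}
    {F : G →* ((TensorProduct ℂ (Fin 2 → ℂ) (Fin 2 → ℂ)) ≃ₗ[ℂ]
      (TensorProduct ℂ (Fin 2 → ℂ) (Fin 2 → ℂ)))} (hF : AsaiProp N s π F) (n : N)
    (hc : s⁻¹ * ↑n * s ∈ N) (t : TensorProduct ℂ (Fin 2 → ℂ) (Fin 2 → ℂ)) :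
    tensorEquivMatrix (F n t) =
      matrixRep π n * tensorEquivMatrix t * (matrixRep π ⟨s⁻¹ * ↑n * s, hc⟩)ᵀ := by
  induction t using TensorProduct.induction_on with
  | zero => simp
  | tmul v w =>
    rw [hF.1 n hc, tensorEquivMatrix_tmul, tensorEquivMatrix_tmul, mul_vecMulVec, vecMulVec_mul,
      vecMul_transpose, matrixRep_mulVec, matrixRep_mulVec]
  | add x y hx hy => simp only [map_add, hx, hy, mul_add, add_mul]

theorem tensorEquivMatrix_asai_swap {G : Type} [Group G] {N : Subgroup G} {s : G}
    {π : ↥N →* ((Fin 2 → ℂ) ≃ₗ[ℂ] (Fin 2 → ℂ))}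
    {F : G →* ((TensorProduct ℂ (Fin 2 → ℂ) (Fin 2 → ℂ)) ≃ₗ[ℂ]
      (TensorProduct ℂ (Fin 2 → ℂ) (Fin 2 → ℂ)))} (hF : AsaiProp N s π F)
    (h2 : s ^ 2 ∈ N) (t : TensorProduct ℂ (Fin 2 → ℂ) (Fin 2 → ℂ)) :
    tensorEquivMatrix (F s t) = matrixRep π ⟨s ^ 2, h2⟩ * (tensorEquivMatrix t)ᵀ := by
  induction t using TensorProduct.induction_on with
  | zero => simp
  | tmul v w =>
    rw [hF.2 h2, tensorEquivMatrix_tmul, tensorEquivMatrix_tmul, transpose_vecMulVec,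
      mul_vecMulVec, matrixRep_mulVec]
  | add x y hx hy => simp only [map_add, hx, hy, mul_add, transpose_add]

theorem exists_intertwining_matrixRep {G : Type} [Group G] {N : Subgroup G} {s : G}
    (hc : ∀ n : N, s⁻¹ * ↑n * s ∈ N) (h2 : s ^ 2 ∈ N)
    {π₁ π₂ : ↥N →* ((Fin 2 → ℂ) ≃ₗ[ℂ] (Fin 2 → ℂ))}
    (hdet : ∀ n : N, LinearMap.det (π₁ n).toLinearMap *
        LinearMap.det (π₁ ⟨s⁻¹ * ↑n * s, hc n⟩).toLinearMap =
      LinearMap.det (π₂ n).toLinearMap * LinearMap.det (π₂ ⟨s⁻¹ * ↑n * s, hc n⟩).toLinearMap)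
    (hdet2 : LinearMap.det (π₁ ⟨s ^ 2, h2⟩).toLinearMap =
      LinearMap.det (π₂ ⟨s ^ 2, h2⟩).toLinearMap)
    {F₁ F₂ : G →* ((TensorProduct ℂ (Fin 2 → ℂ) (Fin 2 → ℂ)) ≃ₗ[ℂ]
      (TensorProduct ℂ (Fin 2 → ℂ) (Fin 2 → ℂ)))}
    (hF₁ : AsaiProp N s π₁ F₁) (hF₂ : AsaiProp N s π₂ F₂)
    {T : (TensorProduct ℂ (Fin 2 → ℂ) (Fin 2 → ℂ)) ≃ₗ[ℂ]
      (TensorProduct ℂ (Fin 2 → ℂ) (Fin 2 → ℂ))} (hT : ∀ g, F₂ g * T = T * F₁ g) :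
    ∃ T' : Matrix (Fin 2) (Fin 2) ℂ →ₗ[ℂ] Matrix (Fin 2) (Fin 2) ℂ,
      (∀ X Y, detPolar (T' X) (T' Y) = detPolar X Y) ∧
      (∀ n X, T' (matrixRep π₁ n * X * (matrixRep π₁ ⟨s⁻¹ * ↑n * s, hc n⟩)ᵀ) =
        matrixRep π₂ n * T' X * (matrixRep π₂ ⟨s⁻¹ * ↑n * s, hc n⟩)ᵀ) ∧
      ∀ X, T' (matrixRep π₁ ⟨s ^ 2, h2⟩ * Xᵀ) = matrixRep π₂ ⟨s ^ 2, h2⟩ * (T' X)ᵀ := by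
  let Φ := tensorEquivMatrix
  obtain ⟨T', hT', h⟩ := exists_isometry_intertwining detPolar_nondegenerate
    (fun X Y => by rw [detPolar_apply, detPolar_apply]; ring) (Φ.symm ≪≫ₗ T ≪≫ₗ Φ)
  have hΦ (g : G) (X) : T' (Φ (F₁ g (Φ.symm X))) = Φ (F₂ g (Φ.symm (T' X))) ↔
      T' ((Φ.symm ≪≫ₗ F₁ g ≪≫ₗ Φ).toLinearMap X) =
        (Φ.symm ≪≫ₗ F₂ g ≪≫ₗ Φ).toLinearMap (T' X) := Iff.rfl
  have hTg (g : G) (X) : (Φ.symm ≪≫ₗ T ≪≫ₗ Φ) ((Φ.symm ≪≫ₗ F₁ g ≪≫ₗ Φ).toLinearMap X) =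
      (Φ.symm ≪≫ₗ F₂ g ≪≫ₗ Φ).toLinearMap ((Φ.symm ≪≫ₗ T ≪≫ₗ Φ) X) := by
    have := LinearEquiv.congr_fun (hT g) (Φ.symm X)
    rw [LinearEquiv.mul_apply, LinearEquiv.mul_apply] at this
    simp [this]
  refine ⟨T', hT', fun n X => ?_, fun X => ?_⟩
  · have e₁ (X) : Φ (F₁ n (Φ.symm X)) =
        matrixRep π₁ n * X * (matrixRep π₁ ⟨s⁻¹ * ↑n * s, hc n⟩)ᵀ := by
      rw [tensorEquivMatrix_asai hF₁ n (hc n), LinearEquiv.apply_symm_apply]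
    have e₂ (X) : Φ (F₂ n (Φ.symm X)) =
        matrixRep π₂ n * X * (matrixRep π₂ ⟨s⁻¹ * ↑n * s, hc n⟩)ᵀ := by
      rw [tensorEquivMatrix_asai hF₂ n (hc n), LinearEquiv.apply_symm_apply]
    rw [← e₁, ← e₂, hΦ]
    refine h _ _ ((matrixRep π₁ n).det * (matrixRep π₁ ⟨s⁻¹ * ↑n * s, hc n⟩).det)
      (LinearEquiv.surjective _) (fun X Y => ?_) (fun X Y => ?_) (hTg n) X
    · change detPolar (Φ (F₁ n (Φ.symm X))) (Φ (F₁ n (Φ.symm Y))) = _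
      rw [e₁, e₁, detPolar_mul_mul, det_transpose]
    · change detPolar (Φ (F₂ n (Φ.symm X))) (Φ (F₂ n (Φ.symm Y))) = _
      rw [e₂, e₂, detPolar_mul_mul, det_transpose]
      simp only [det_matrixRep, hdet]
  · have e₁ (X) : Φ (F₁ s (Φ.symm X)) = matrixRep π₁ ⟨s ^ 2, h2⟩ * Xᵀ := by
      rw [tensorEquivMatrix_asai_swap hF₁ h2, LinearEquiv.apply_symm_apply]
    have e₂ (X) : Φ (F₂ s (Φ.symm X)) = matrixRep π₂ ⟨s ^ 2, h2⟩ * Xᵀ := by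
      rw [tensorEquivMatrix_asai_swap hF₂ h2, LinearEquiv.apply_symm_apply]
    have hpol (M X Y : Matrix (Fin 2) (Fin 2) ℂ) :
        detPolar (M * Xᵀ) (M * Yᵀ) = M.det * detPolar X Y := by
      simpa [detPolar_transpose] using detPolar_mul_mul M Xᵀ Yᵀ 1
    rw [← e₁, ← e₂, hΦ]
    refine h _ _ (matrixRep π₁ ⟨s ^ 2, h2⟩).det
      (LinearEquiv.surjective _) (fun X Y => ?_) (fun X Y => ?_) (hTg s) X
    · change detPolar (Φ (F₁ s (Φ.symm X))) (Φ (F₁ s (Φ.symm Y))) = _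
      rw [e₁, e₁, hpol]
    · change detPolar (Φ (F₂ s (Φ.symm X))) (Φ (F₂ s (Φ.symm Y))) = _
      rw [e₂, e₂, hpol, det_matrixRep, det_matrixRep, hdet2]

theorem exists_linearEquiv_conj {P : Matrix (Fin 2) (Fin 2) ℂ} (hP : P.det ≠ 0) :
    ∃ C : (Fin 2 → ℂ) ≃ₗ[ℂ] (Fin 2 → ℂ), ∀ (M M' : Matrix (Fin 2) (Fin 2) ℂ) (c : ℂ),
      P * M = c • (M' * P) → ∀ v, c • (M' *ᵥ v) = C (M *ᵥ C.symm v) := by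
  refine ⟨toLinearEquiv' P (invertibleOfIsUnitDet P hP.isUnit), fun M M' c h v => ?_⟩
  obtain ⟨w, rfl⟩ := (toLinearEquiv' P (invertibleOfIsUnitDet P hP.isUnit)).surjective v
  rw [LinearEquiv.symm_apply_apply]
  change c • (M' *ᵥ (P *ᵥ w)) = P *ᵥ (M *ᵥ w)
  rw [mulVec_mulVec, mulVec_mulVec, h, smul_mulVec]

theorem intertwines_of_generators {G : Type} [Group G] {N : Subgroup G} (hN : N.index = 2)
    {s : G} (hs : s ∉ N) {H : Type*} [Group H] {F₁ F₂ : G →* H} {T : H}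
    (hn : ∀ n : N, F₂ n * T = T * F₁ n) (hTs : F₂ s * T = T * F₁ s) (g : G) :
    F₂ g = T * F₁ g * T⁻¹ := by
  rw [eq_mul_inv_iff_mul_eq]
  by_cases hg : g ∈ N
  · exact hn ⟨g, hg⟩
  · have hgs : g * s⁻¹ ∈ N :=
      (Subgroup.mul_mem_iff_of_index_two hN).mpr (by simp [hg, hs])
    obtain ⟨n, rfl⟩ : ∃ n : N, g = n * s := ⟨⟨g * s⁻¹, hgs⟩, by simp⟩
    rw [map_mul, map_mul, mul_assoc, hTs, ← mul_assoc, hn, mul_assoc]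

end

/-- Fibers of the Asai (tensor induction) lift: for `N ≤ G` of index 2, `s ∈ G ∖ N`,
and two-dimensional representations `π₁, π₂ : N → GL(ℂ²)` whose determinants have
equal transfer characters `r(det π₁) = r(det π₂)`, the tensor inductions `As(π₁)` and
`As(π₂)` are conjugate in `GL(ℂ² ⊗ ℂ²)` if and only if there is a character
`χ : N → ℂˣ` with trivial transfer character `r(χ)` such that `π₂ ⊗ χ` is conjugate in
`GL(ℂ²)` to `π₁` or to `π₁ ∘ σ`, where `σ(n) = s⁻¹ n s`. -/
theorem stmt_11 (G : Type) [Group G] (N : Subgroup G) (hN : N.index = 2)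
    (s : G) (hs : s ∉ N)
    (π₁ π₂ : ↥N →* ((Fin 2 → ℂ) ≃ₗ[ℂ] (Fin 2 → ℂ)))
    (hdet : (∀ (n : ↥N) (hc : s⁻¹ * ↑n * s ∈ N),
        LinearMap.det (π₁ n).toLinearMap *
            LinearMap.det (π₁ ⟨s⁻¹ * ↑n * s, hc⟩).toLinearMap =
          LinearMap.det (π₂ n).toLinearMap *
            LinearMap.det (π₂ ⟨s⁻¹ * ↑n * s, hc⟩).toLinearMap)
      ∧ (∀ g : G, g ∉ N → ∀ (h2 : g ^ 2 ∈ N),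
        LinearMap.det (π₁ ⟨g ^ 2, h2⟩).toLinearMap =
          LinearMap.det (π₂ ⟨g ^ 2, h2⟩).toLinearMap))
    (F₁ F₂ : G →* ((TensorProduct ℂ (Fin 2 → ℂ) (Fin 2 → ℂ)) ≃ₗ[ℂ]
      (TensorProduct ℂ (Fin 2 → ℂ) (Fin 2 → ℂ))))
    (hF₁ : AsaiProp N s π₁ F₁) (hF₂ : AsaiProp N s π₂ F₂) :
    (∃ T : (TensorProduct ℂ (Fin 2 → ℂ) (Fin 2 → ℂ)) ≃ₗ[ℂ]
        (TensorProduct ℂ (Fin 2 → ℂ) (Fin 2 → ℂ)),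
      ∀ g : G, F₂ g = T * F₁ g * T⁻¹) ↔
    ∃ χ : ↥N →* ℂˣ,
      ((∀ (n : ↥N) (hc : s⁻¹ * ↑n * s ∈ N), χ n * χ ⟨s⁻¹ * ↑n * s, hc⟩ = 1)
        ∧ (∀ g : G, g ∉ N → ∀ (h2 : g ^ 2 ∈ N), χ ⟨g ^ 2, h2⟩ = 1))
      ∧ ((∃ C : (Fin 2 → ℂ) ≃ₗ[ℂ] (Fin 2 → ℂ), ∀ (n : ↥N) (v : Fin 2 → ℂ),
            (χ n : ℂ) • π₂ n v = C (π₁ n (C.symm v)))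
        ∨ (∃ C : (Fin 2 → ℂ) ≃ₗ[ℂ] (Fin 2 → ℂ),
            ∀ (n : ↥N) (hc : s⁻¹ * ↑n * s ∈ N) (v : Fin 2 → ℂ),
            (χ n : ℂ) • π₂ n v = C (π₁ ⟨s⁻¹ * ↑n * s, hc⟩ (C.symm v)))) := by
  have := Subgroup.normal_of_index_eq_two hN
  have hc (n : N) : s⁻¹ * ↑n * s ∈ N := by
    simpa using this.conj_mem n n.2 s⁻¹
  have h2 : s ^ 2 ∈ N := Subgroup.sq_mem_of_index_two hN s
  let σ : N →* N :=
    { toFun := fun n => ⟨s⁻¹ * ↑n * s, hc n⟩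
      map_one' := Subtype.ext (by simp)
      map_mul' := fun m n => Subtype.ext (by simp [mul_assoc]) }
  let z : N := ⟨s ^ 2, h2⟩
  have hσz : σ z = z := Subtype.ext (by simp [σ, z, sq])
  have hσσ (n : N) : z * σ (σ n) = n * z := Subtype.ext (by simp [σ, z, sq, mul_assoc])
  constructor
  · rintro ⟨T, hT⟩
    obtain ⟨T', hT', hT'n, hT'z⟩ := exists_intertwining_matrixRep hc h2 (fun n => hdet.1 n (hc n))
      (hdet.2 s hs h2) hF₁ hF₂ fun g => eq_mul_inv_iff_mul_eq.mp (hT g)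
    obtain ⟨χ, hχσ, hχz, P, hP, h⟩ := exists_character_of_intertwining σ z hσz hσσ
      (matrixRep π₁) (matrixRep π₂) hT' hT'n hT'z
    obtain ⟨C, hC⟩ := exists_linearEquiv_conj hP
    refine ⟨χ, ⟨fun n _ => hχσ n, fun g hg hg2 => ?_⟩, h.imp (fun h => ⟨C, fun n v => ?_⟩)
      (fun h => ⟨C, fun n _ v => ?_⟩)⟩
    · have hgs : g * s⁻¹ ∈ N :=
        (Subgroup.mul_mem_iff_of_index_two hN).mpr (by simp [hg, hs])
      have hgz : (⟨g ^ 2, hg2⟩ : N) = ⟨g * s⁻¹, hgs⟩ * z * σ ⟨g * s⁻¹, hgs⟩ :=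
        Subtype.ext (by simp [σ, z, sq, mul_assoc])
      rw [hgz, map_mul, map_mul, hχz, mul_one, hχσ]
    · simpa only [matrixRep_mulVec] using hC _ _ _ (h n) v
    · have := hC _ _ _ (h n) v
      simp only [matrixRep_mulVec] at this
      exact this
  · rintro ⟨χ, ⟨hχσ, hχ2⟩, h⟩
    have hχz : (χ z : ℂ) = 1 := congrArg Units.val (hχ2 s hs h2)
    have hχn (n : N) : (χ n : ℂ) * χ (σ n) = 1 := congrArg Units.val (hχσ n (hc n))
    have hF₁n (n : N) (v w) : F₁ n (v ⊗ₜ[ℂ] w) = π₁ n v ⊗ₜ[ℂ] π₁ (σ n) w := hF₁.1 n (hc n) v w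
    have hF₂n (n : N) (v w) : F₂ n (v ⊗ₜ[ℂ] w) = π₂ n v ⊗ₜ[ℂ] π₂ (σ n) w := hF₂.1 n (hc n) v w
    have hF₁s (v w) : F₁ s (v ⊗ₜ[ℂ] w) = π₁ z w ⊗ₜ[ℂ] v := hF₁.2 h2 v w
    have hF₂s (v w) : F₂ s (v ⊗ₜ[ℂ] w) = π₂ z w ⊗ₜ[ℂ] v := hF₂.2 h2 v w
    obtain ⟨C, hC⟩ | ⟨C, hC⟩ := h
    · have hC' (n : N) (v) : C (π₁ n v) = (χ n : ℂ) • π₂ n (C v) := by simp [hC]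
      refine ⟨TensorProduct.congr C C, intertwines_of_generators hN hs (fun n => ?_) ?_⟩
      · refine LinearEquiv.toLinearMap_injective (TensorProduct.ext' fun v w => ?_)
        change F₂ n (C v ⊗ₜ[ℂ] C w) = TensorProduct.congr C C (F₁ n (v ⊗ₜ[ℂ] w))
        rw [hF₁n, hF₂n, TensorProduct.congr_tmul, hC', hC', TensorProduct.smul_tmul_smul, hχn,
          one_smul]
      · refine LinearEquiv.toLinearMap_injective (TensorProduct.ext' fun v w => ?_)
        change F₂ s (C v ⊗ₜ[ℂ] C w) = TensorProduct.congr C C (F₁ s (v ⊗ₜ[ℂ] w))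
        rw [hF₁s, hF₂s, TensorProduct.congr_tmul, hC', hχz, one_smul]
    · have hC' (n : N) (v) : C (π₁ (σ n) v) = (χ n : ℂ) • π₂ n (C v) := by
        simpa [σ] using (hC n (hc n) (C v)).symm
      have hCz (v) : C (π₁ z v) = π₂ z (C v) := by
        rw [← one_smul ℂ (π₂ z _), ← hχz, ← hC', hσz]
      let D := C ≪≫ₗ (π₂ z).symm
      have hD (v) : π₂ z (D v) = C v := (π₂ z).apply_symm_apply (C v)
      let T := TensorProduct.comm ℂ (Fin 2 → ℂ) (Fin 2 → ℂ) ≪≫ₗ TensorProduct.congr C D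
      have hT (v w) : T (v ⊗ₜ[ℂ] w) = C w ⊗ₜ[ℂ] D v := rfl
      have hDz (v) : D (π₁ z v) = C v := (π₂ z).symm_apply_eq.mpr (hCz v)
      have hDn (n : N) (v) : D (π₁ n v) = (χ (σ n) : ℂ) • π₂ (σ n) (D v) := by
        have hmul₁ (v) : π₁ z (π₁ (σ (σ n)) v) = π₁ n (π₁ z v) := by
          rw [← LinearEquiv.mul_apply, ← map_mul, hσσ, map_mul, LinearEquiv.mul_apply]
        obtain ⟨u, rfl⟩ := (π₁ z).surjective v
        rw [← hmul₁, hDz, hDz, hC']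
      refine ⟨T, intertwines_of_generators hN hs (fun n => ?_) ?_⟩
      · refine LinearEquiv.toLinearMap_injective (TensorProduct.ext' fun v w => ?_)
        change F₂ n (T (v ⊗ₜ[ℂ] w)) = T (F₁ n (v ⊗ₜ[ℂ] w))
        rw [hF₁n, hT, hT, hF₂n, hC', hDn, TensorProduct.smul_tmul_smul, hχn, one_smul]
      · refine LinearEquiv.toLinearMap_injective (TensorProduct.ext' fun v w => ?_)
        change F₂ s (T (v ⊗ₜ[ℂ] w)) = T (F₁ s (v ⊗ₜ[ℂ] w))
        rw [hF₁s, hT, hT, hF₂s, hD, hDz]
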